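/- arXiv:0902.3456 — 5 statements merged into one kernel-verified Lean document; each statement's English description precedes it below -/
import Mathlib

section
/- Let K > 0 and let z be a complex number with Im z < 0. Then the function x ↦ e^{izx}·(K − e^x)^+ is Lebesgue-integrable on ℝ and ∫_ℝ e^{izx}·(K − e^x)^+ dx = K^{1+iz} / (iz·(1+iz)), where K^{1+iz} = exp((1+iz)·log K). -/
open MeasureTheory Complex

/-- For `K > 0` and `z : ℂ` with `Im z < 0`, the function `x ↦ e^{izx} · (K − e^x)⁺`
is Lebesgue-integrable on `ℝ` and its integral (the Fourier transform of the put payoff)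
equals `K^{1+iz} / (iz·(1+iz))`, where `K^{1+iz} = exp((1+iz)·log K)`. -/
theorem put_payoff_fourier_transform (K : ℝ) (hK : 0 < K) (z : ℂ) (hz : z.im < 0) :
    Integrable (fun x : ℝ =>
        Complex.exp (Complex.I * z * x) * ((max (K - Real.exp x) 0 : ℝ) : ℂ)) ∧
    ∫ x : ℝ, Complex.exp (Complex.I * z * x) * ((max (K - Real.exp x) 0 : ℝ) : ℂ)
      = Complex.exp ((1 + Complex.I * z) * Real.log K)
          / (Complex.I * z * (1 + Complex.I * z)) := by
  have ha : 0 < (Complex.I * z).re := by simpa using hz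
  have hb : 0 < (1 + Complex.I * z).re := by
    rw [Complex.add_re, Complex.one_re]; linarith
  have hf : (fun x : ℝ =>
      Complex.exp (Complex.I * z * x) * ((max (K - Real.exp x) 0 : ℝ) : ℂ)) =
      (Set.Iic (Real.log K)).indicator (fun x : ℝ =>
        K * Complex.exp (Complex.I * z * x) - Complex.exp ((1 + Complex.I * z) * x)) := by
    funext x
    by_cases hx : x ≤ Real.log K
    · rw [Set.indicator_of_mem (Set.mem_Iic.mpr hx),
        max_eq_left (sub_nonneg.mpr ((Real.le_log_iff_exp_le hK).mp hx)),
        add_mul, one_mul, Complex.exp_add]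
      push_cast
      ring
    · rw [Set.indicator_of_notMem (by simpa using hx), max_eq_right, Complex.ofReal_zero, mul_zero]
      exact sub_nonpos.mpr ((Real.log_le_iff_le_exp hK).mp (not_le.mp hx).le)
  have hia := (integrableOn_exp_mul_complex_Iic ha (Real.log K)).const_mul (K : ℂ)
  have hib := integrableOn_exp_mul_complex_Iic hb (Real.log K)
  rw [hf]
  refine ⟨(integrable_indicator_iff measurableSet_Iic).mpr (hia.sub hib), ?_⟩
  rw [integral_indicator measurableSet_Iic, integral_sub hia hib, integral_const_mul,
    integral_exp_mul_complex_Iic ha, integral_exp_mul_complex_Iic hb, add_mul, one_mul,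
    Complex.exp_add, ← Complex.ofReal_exp, Real.exp_log hK]
  have ha0 : Complex.I * z ≠ 0 := fun h => by simp [h] at ha
  have hb0 : 1 + Complex.I * z ≠ 0 := fun h => by simp [h] at hb
  generalize Complex.I * z = w at *
  field_simp
  ring
end

section
/- Let K > 0, R > 1 and x ∈ ℝ. Then the function u ↦ e^{(R−iu)x} · K^{1+iu−R} / ((iu−R)·(1+iu−R)) is Lebesgue-integrable on ℝ and (e^x − K)^+ = (1/2π) · ∫_ℝ e^{(R−iu)x} · K^{1+iu−R} / ((iu−R)·(1+iu−R)) du. -/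
open MeasureTheory Complex Real

open scoped FourierTransform

/-- The call payoff with log-strike `c`, damped by `exp (-R t)`. -/
noncomputable def dampedCall (R c t : ℝ) : ℂ :=
  (Real.exp (-R * t) * max (Real.exp t - Real.exp c) 0 : ℝ)

lemma continuous_dampedCall (R c : ℝ) : Continuous (dampedCall R c) := by
  unfold dampedCall
  fun_prop

lemma exp_mul_dampedCall (R c : ℝ) (a : ℂ) :
    (fun t : ℝ => Complex.exp (a * t) * dampedCall R c t) =
      (Set.Ioi c).indicator (fun t : ℝ => Complex.exp ((1 + a - R) * t) -
        Complex.exp c * Complex.exp ((a - R) * t)) := by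
  ext t
  by_cases ht : c < t
  · rw [Set.indicator_of_mem (Set.mem_Ioi.2 ht), dampedCall,
      max_eq_left (sub_nonneg.2 (Real.exp_le_exp.2 ht.le))]
    push_cast
    rw [mul_sub, mul_sub, ← Complex.exp_add, ← Complex.exp_add, ← Complex.exp_add,
      ← Complex.exp_add, ← Complex.exp_add]
    ring_nf
  · rw [Set.indicator_of_notMem (by simpa using ht), dampedCall,
      max_eq_right (sub_nonpos.2 (Real.exp_le_exp.2 (not_lt.1 ht)))]
    simp

lemma integrable_dampedCall {R : ℝ} (hR : 1 < R) (c : ℝ) : Integrable (dampedCall R c) := by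
  have h := exp_mul_dampedCall R c 0
  simp only [zero_mul, Complex.exp_zero, one_mul] at h
  change Integrable (fun t => dampedCall R c t)
  rw [h, integrable_indicator_iff measurableSet_Ioi]
  refine Integrable.sub (integrableOn_exp_mul_complex_Ioi ?_ c)
    ((integrableOn_exp_mul_complex_Ioi ?_ c).const_mul _)
  · simpa using hR
  · simpa using zero_lt_one.trans hR

lemma integral_exp_mul_dampedCall {R : ℝ} (hR : 1 < R) (c u : ℝ) :
    ∫ t : ℝ, Complex.exp (Complex.I * u * t) * dampedCall R c t =
      Complex.exp ((1 + Complex.I * u - R) * c) /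
        ((Complex.I * u - R) * (1 + Complex.I * u - R)) := by
  have h₁ : (1 + Complex.I * u - R).re < 0 := by simpa using hR
  have h₀ : (Complex.I * u - R).re < 0 := by simpa using zero_lt_one.trans hR
  have n₁ : 1 + Complex.I * u - R ≠ 0 := fun h => by simp [h] at h₁
  have n₀ : Complex.I * u - R ≠ 0 := fun h => by simp [h] at h₀
  rw [exp_mul_dampedCall, integral_indicator measurableSet_Ioi,
    integral_sub (integrableOn_exp_mul_complex_Ioi h₁ c)
      ((integrableOn_exp_mul_complex_Ioi h₀ c).const_mul _),
    integral_const_mul, integral_exp_mul_complex_Ioi h₁, integral_exp_mul_complex_Ioi h₀]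
  have e : Complex.exp ((1 + Complex.I * u - R) * c) =
      Complex.exp c * Complex.exp ((Complex.I * u - R) * c) := by
    rw [← Complex.exp_add]
    ring_nf
  rw [e]
  field_simp
  ring

lemma fourier_dampedCall {R : ℝ} (hR : 1 < R) (c w : ℝ) :
    𝓕 (dampedCall R c) w =
      Complex.exp ((1 + Complex.I * (-2 * π * w : ℝ) - R) * c) /
        ((Complex.I * (-2 * π * w : ℝ) - R) * (1 + Complex.I * (-2 * π * w : ℝ) - R)) := by
  rw [← integral_exp_mul_dampedCall hR, Real.fourier_real_eq_integral_exp_smul]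
  congr 1
  ext t
  rw [smul_eq_mul]
  congr 2
  push_cast
  ring

lemma integrable_exp_div {R : ℝ} (hR : 1 < R) (c x : ℝ) :
    Integrable (fun u : ℝ => Complex.exp (((R : ℂ) - Complex.I * u) * x) *
      Complex.exp ((1 + Complex.I * u - R) * c) /
        ((Complex.I * u - R) * (1 + Complex.I * u - R))) := by
  have hR' : 0 < R - 1 := sub_pos.2 hR
  have h₁ (u : ℝ) : 1 + Complex.I * u - R ≠ 0 := fun h => by
    have := congrArg Complex.re h
    simp at this
    linarith
  have h₀ (u : ℝ) : Complex.I * u - R ≠ 0 := fun h => by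
    have := congrArg Complex.re h
    simp at this
    linarith
  refine ((integrable_inv_one_add_sq.comp_div hR'.ne').const_mul
    (Real.exp (R * x) * Real.exp ((1 - R) * c) / (R - 1) ^ 2)).mono'
    (Continuous.aestronglyMeasurable ?_) (.of_forall fun u => ?_)
  · exact Continuous.div (by fun_prop) (by fun_prop) fun u => mul_ne_zero (h₀ u) (h₁ u)
  · have hle : (R - 1) ^ 2 + u ^ 2 ≤ ‖Complex.I * u - R‖ * ‖1 + Complex.I * u - R‖ := by
      have e₁ : ‖1 + Complex.I * u - R‖ ^ 2 = (R - 1) ^ 2 + u ^ 2 := by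
        rw [← Complex.normSq_eq_norm_sq, Complex.normSq_apply]
        simp
        ring
      have e₀ : ‖Complex.I * u - R‖ ^ 2 = R ^ 2 + u ^ 2 := by
        rw [← Complex.normSq_eq_norm_sq, Complex.normSq_apply]
        simp
        ring
      have : ‖1 + Complex.I * u - R‖ ≤ ‖Complex.I * u - R‖ :=
        le_of_sq_le_sq (by rw [e₀, e₁]; nlinarith) (norm_nonneg _)
      rw [← e₁, sq]
      gcongr
    rw [norm_div, norm_mul, norm_mul, Complex.norm_exp, Complex.norm_exp]
    have r₁ : (((R : ℂ) - Complex.I * u) * x).re = R * x := by simp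
    have r₂ : ((1 + Complex.I * u - R) * c).re = (1 - R) * c := by simp
    rw [r₁, r₂]
    calc _ ≤ Real.exp (R * x) * Real.exp ((1 - R) * c) / ((R - 1) ^ 2 + u ^ 2) := by gcongr
      _ = _ := by field_simp

/-- Fourier inversion for the exponentially damped call payoff: for `K > 0`, `R > 1`
and `x ∈ ℝ`, the function `u ↦ e^{(R−iu)x} · K^{1+iu−R} / ((iu−R)(1+iu−R))` is
Lebesgue-integrable on `ℝ` and
`(e^x − K)⁺ = (1/2π) ∫_ℝ e^{(R−iu)x} · K^{1+iu−R} / ((iu−R)(1+iu−R)) du`. -/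
theorem call_payoff_fourier_inversion (K R x : ℝ) (hK : 0 < K) (hR : 1 < R) :
    Integrable (fun u : ℝ =>
        Complex.exp (((R : ℂ) - Complex.I * u) * x) *
          Complex.exp ((1 + Complex.I * u - R) * Real.log K) /
            ((Complex.I * u - R) * (1 + Complex.I * u - R))) ∧
    ((max (Real.exp x - K) 0 : ℝ) : ℂ)
      = (1 / (2 * (π : ℂ))) *
          ∫ u : ℝ, Complex.exp (((R : ℂ) - Complex.I * u) * x) *
            Complex.exp ((1 + Complex.I * u - R) * Real.log K) /
              ((Complex.I * u - R) * (1 + Complex.I * u - R)) := by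
  have hint := integrable_exp_div hR (Real.log K) x
  refine ⟨hint, ?_⟩
  set F : ℝ → ℂ := fun u => Complex.exp (((R : ℂ) - Complex.I * u) * x) *
    Complex.exp ((1 + Complex.I * u - R) * Real.log K) /
      ((Complex.I * u - R) * (1 + Complex.I * u - R)) with hF
  have h2π : (-2 * π : ℝ) ≠ 0 := by simp [Real.pi_ne_zero]
  have hfourier (w : ℝ) : 𝓕 (dampedCall R (Real.log K)) w =
      Complex.exp (-((R : ℂ) - Complex.I * (-2 * π * w : ℝ)) * x) * F (-2 * π * w) := by
    simp only [fourier_dampedCall hR, hF]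
    rw [← mul_div_assoc, ← mul_assoc, ← Complex.exp_add, neg_mul (_ - _), neg_add_cancel,
      Complex.exp_zero, one_mul]
  have hexp (w : ℝ) : Complex.exp ((2 * π * (w * x) : ℝ) * Complex.I) *
      𝓕 (dampedCall R (Real.log K)) w = Complex.exp (-(R * x)) * F (-2 * π * w) := by
    rw [hfourier, ← mul_assoc, ← Complex.exp_add]
    congr 2
    push_cast
    ring
  have hFint : Integrable (𝓕 (dampedCall R (Real.log K))) := by
    have h := (integrable_exp_div hR (Real.log K) 0).comp_mul_left' h2π
    refine h.congr (.of_forall fun w => ?_)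
    simp only [fourier_dampedCall hR]
    simp
  have hinv := congrFun ((continuous_dampedCall R (Real.log K)).fourierInv_fourier_eq
    (integrable_dampedCall hR _) hFint) x
  rw [Real.fourierInv_eq'] at hinv
  have hscale : ∫ w : ℝ, Complex.exp (-(R * x)) * F (-2 * π * w) =
      Complex.exp (-(R * x)) * ((1 / (2 * (π : ℂ))) * ∫ u, F u) := by
    rw [integral_const_mul, Measure.integral_comp_mul_left F]
    congr 1
    rw [abs_inv, neg_mul, abs_neg, abs_of_pos Real.two_pi_pos, Complex.real_smul]
    push_cast
    rw [one_div]
  have hpayoff : dampedCall R (Real.log K) x =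
      Complex.exp (-(R * x)) * ((max (Real.exp x - K) 0 : ℝ) : ℂ) := by
    rw [dampedCall, Real.exp_log hK]
    push_cast
    rw [neg_mul]
  refine mul_left_cancel₀ (Complex.exp_ne_zero (-(R * x))) ?_
  rw [← hpayoff, ← hscale, ← hinv]
  congr 1
  ext w
  rw [← hexp, smul_eq_mul]
  simp [mul_comm]
end

section
/- Let (Ω, 𝓕, P) be a probability space, H : Ω → ℝ a random variable, K > 0 and R > 1, and suppose E[e^{RH}] < ∞. Then the function u ↦ M_H(R−iu) · K^{1+iu−R} / ((iu−R)·(1+iu−R)) is Lebesgue-integrable on ℝ, where M_H(z) = E[e^{zH}]. -/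
open MeasureTheory Complex

lemma Complex.norm_I_mul_ofReal_add_sq (a u : ℝ) : ‖Complex.I * u + a‖ ^ 2 = a ^ 2 + u ^ 2 := by
  rw [← Complex.normSq_eq_norm_sq, Complex.normSq_apply]
  simp
  ring

lemma integrable_inv_sq_add_sq {a : ℝ} (ha : 0 < a) :
    Integrable fun u : ℝ => (a ^ 2 + u ^ 2)⁻¹ := by
  refine (integrable_inv_one_add_sq.const_mul (1 + (a ^ 2)⁻¹)).mono'
    (by fun_prop) (.of_forall fun u => ?_)
  rw [Real.norm_of_nonneg (by positivity), ← div_eq_mul_inv, inv_le_iff_one_le_mul₀ (by positivity),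
    div_mul_eq_mul_div, le_div_iff₀ (by positivity)]
  have h : (a ^ 2)⁻¹ * a ^ 2 = 1 := inv_mul_cancel₀ (by positivity)
  have h' : 0 ≤ (a ^ 2)⁻¹ * u ^ 2 := by positivity
  nlinarith [sq_nonneg a]

lemma norm_cexp_sub_I_mul_mul (R u x : ℝ) :
    ‖Complex.exp (((R : ℂ) - Complex.I * u) * x)‖ = Real.exp (R * x) := by
  rw [Complex.norm_exp]
  simp

lemma continuous_integral_cexp_sub_I_mul {Ω : Type*} [MeasurableSpace Ω] {P : Measure Ω}
    {H : Ω → ℝ} (hH : Measurable H) {R : ℝ} (hInt : Integrable (fun ω => Real.exp (R * H ω)) P) :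
    Continuous fun u : ℝ => ∫ ω, Complex.exp (((R : ℂ) - Complex.I * u) * H ω) ∂P :=
  continuous_of_dominated (fun u => by fun_prop)
    (fun u => .of_forall fun ω => (norm_cexp_sub_I_mul_mul R u (H ω)).le) hInt
    (.of_forall fun ω => by fun_prop)

/-- If `H` is a real random variable with `E[e^{RH}] < ∞`, `K > 0` and `R > 1`, then
the function `u ↦ M_H(R−iu) · K^{1+iu−R} / ((iu−R)(1+iu−R))` is Lebesgue-integrable
on `ℝ`, where `M_H(z) = E[e^{zH}]`. -/
theorem cap_pricing_integrand_integrable {Ω : Type*} [MeasurableSpace Ω] (P : Measure Ω)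
    [IsProbabilityMeasure P] (H : Ω → ℝ) (hH : Measurable H) (K R : ℝ)
    (hK : 0 < K) (hR : 1 < R)
    (hInt : Integrable (fun ω => Real.exp (R * H ω)) P) :
    Integrable (fun u : ℝ =>
      (∫ ω, Complex.exp (((R : ℂ) - Complex.I * u) * H ω) ∂P) *
        Complex.exp ((1 + Complex.I * u - R) * Real.log K) /
          ((Complex.I * u - R) * (1 + Complex.I * u - R))) := by
  have hden (u : ℝ) : (R - 1) ^ 2 + u ^ 2 ≤
      ‖(Complex.I * u - R) * (1 + Complex.I * u - R)‖ := by
    have h₁ := Complex.norm_I_mul_ofReal_add_sq (-R) u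
    have h₂ := Complex.norm_I_mul_ofReal_add_sq (1 - R) u
    rw [show Complex.I * u + ((-R : ℝ) : ℂ) = Complex.I * u - R by push_cast; ring] at h₁
    rw [show Complex.I * u + ((1 - R : ℝ) : ℂ) = 1 + Complex.I * u - R by push_cast; ring] at h₂
    have h : ‖1 + Complex.I * u - R‖ ≤ ‖Complex.I * u - R‖ :=
      (sq_le_sq₀ (norm_nonneg _) (norm_nonneg _)).1 (by nlinarith)
    rw [norm_mul]
    nlinarith [norm_nonneg (1 + Complex.I * u - R)]
  have hpos (u : ℝ) : 0 < (R - 1) ^ 2 + u ^ 2 := by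
    have := sub_pos.2 hR
    positivity
  have hcont := continuous_integral_cexp_sub_I_mul hH hInt
  refine ((integrable_inv_sq_add_sq (sub_pos.2 hR)).const_mul
    ((∫ ω, Real.exp (R * H ω) ∂P) * Real.exp ((1 - R) * Real.log K))).mono'
    (Continuous.aestronglyMeasurable ?_) (.of_forall fun u => ?_)
  · exact (hcont.mul (by fun_prop)).div (by fun_prop)
      fun u => norm_pos_iff.1 ((hpos u).trans_le (hden u))
  · rw [norm_div, norm_mul, div_eq_mul_inv]
    have hM : ‖∫ ω, Complex.exp (((R : ℂ) - Complex.I * u) * H ω) ∂P‖ ≤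
        ∫ ω, Real.exp (R * H ω) ∂P :=
      norm_integral_le_of_norm_le hInt (.of_forall fun ω => (norm_cexp_sub_I_mul_mul R u (H ω)).le)
    have hexp : ‖Complex.exp ((1 + Complex.I * u - R) * Real.log K)‖ =
        Real.exp ((1 - R) * Real.log K) := by
      rw [Complex.norm_exp, Complex.re_mul_ofReal]
      simp
    rw [hexp]
    gcongr
    exact hden u
end

section
/- Let (Ω, 𝓕, P) be a probability space, H : Ω → ℝ a random variable, K > 0 and R < 0, and suppose E[e^{RH}] < ∞. Then E[(K − e^H)^+] = (1/2π) · ∫_ℝ M_H(R−iu) · K^{1+iu−R} / ((iu−R)·(1+iu−R)) du, where M_H(z) = E[e^{zH}]. -/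
open MeasureTheory Complex Real

/-- The Mellin transform of the put payoff with unit strike. -/
theorem hasMellin_max_one_sub {s : ℂ} (hs : 0 < s.re) :
    HasMellin (fun t : ℝ => ((max (1 - t) 0 : ℝ) : ℂ)) s (1 / (s * (s + 1))) := by
  have hs1 : 0 < (s + 1).re := by simp; linarith
  have hne : s ≠ 0 := by rintro rfl; simp at hs
  have hne1 : s + 1 ≠ 0 := by intro h; simp [h] at hs1
  have h := hasMellin_sub (hasMellin_one_Ioc hs).1 (hasMellin_cpow_Ioc 1 hs1).1
  rw [(hasMellin_one_Ioc hs).2, (hasMellin_cpow_Ioc 1 hs1).2] at h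
  have hval : 1 / s - 1 / (s + 1) = 1 / (s * (s + 1)) := by field_simp; ring
  rw [hval] at h
  have heq : ∀ t ∈ Set.Ioi (0 : ℝ),
      (Set.indicator (Set.Ioc 0 1) (fun _ => (1 : ℂ)) t -
        Set.indicator (Set.Ioc 0 1) (fun t : ℝ => (t : ℂ) ^ (1 : ℂ)) t) =
      ((max (1 - t) 0 : ℝ) : ℂ) := by
    intro t ht
    rw [Set.mem_Ioi] at ht
    rcases le_or_gt t 1 with h1 | h1
    · simp [Set.indicator, ht, h1]
    · simp [Set.indicator, h1.not_ge, h1.le]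
  refine ⟨(integrableOn_congr_fun (fun t ht => ?_) measurableSet_Ioi).1 h.1, ?_⟩
  · simp only [heq t ht]
  · rw [← h.2]
    refine setIntegral_congr_fun measurableSet_Ioi fun t ht => ?_
    simp only [heq t ht]

theorem integrable_inv_vertical_mul_add_one {σ : ℝ} (hσ : 0 < σ) :
    Integrable fun u : ℝ => 1 / (((σ : ℂ) + u * I) * ((σ : ℂ) + u * I + 1)) := by
  have hne (u : ℝ) : (σ : ℂ) + u * I ≠ 0 := fun h => by
    have := congrArg re h; simp at this; linarith
  have hne1 (u : ℝ) : (σ : ℂ) + u * I + 1 ≠ 0 := fun h => by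
    have := congrArg re h; simp at this; linarith
  set c := min σ 1
  have hc0 : 0 < c := lt_min hσ one_pos
  have hcσ : c ≤ σ := min_le_left _ _
  have hc1 : c ≤ 1 := min_le_right _ _
  refine (integrable_inv_one_add_sq.const_mul c⁻¹).mono' ?_ (.of_forall fun u => ?_)
  · refine Continuous.aestronglyMeasurable ?_
    exact continuous_const.div (by fun_prop) fun u => mul_ne_zero (hne u) (hne1 u)
  · rw [norm_div, norm_one, one_div, ← mul_inv]
    refine inv_anti₀ (by positivity) ?_
    refine (sq_le_sq₀ (by positivity) (norm_nonneg _)).1 ?_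
    rw [norm_mul, mul_pow, mul_pow, Complex.sq_norm, Complex.sq_norm, normSq_apply, normSq_apply]
    simp only [add_re, ofReal_re, mul_re, I_re, mul_zero, ofReal_im, I_im, mul_one, sub_self,
      add_zero, add_im, mul_im, zero_add, one_re, one_im]
    have h1 : c ^ 2 * (1 + u ^ 2) ≤ σ * σ + u * u := by
      have h3 : c ^ 2 ≤ σ ^ 2 := by gcongr
      have h4 : c ^ 2 ≤ 1 := pow_le_one₀ hc0.le hc1
      nlinarith [mul_le_mul_of_nonneg_right h4 (sq_nonneg u)]
    have h2 : 1 + u ^ 2 ≤ (σ + 1) * (σ + 1) + u * u := by nlinarith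
    calc c ^ 2 * (1 + u ^ 2) ^ 2 = c ^ 2 * (1 + u ^ 2) * (1 + u ^ 2) := by ring
      _ ≤ _ := mul_le_mul h1 h2 (by positivity) (h1.trans' (by positivity))

/-- Mellin inversion for the put payoff. -/
theorem put_payoff_eq_integral (K R h : ℝ) (hK : 0 < K) (hR : R < 0) :
    ((max (K - Real.exp h) 0 : ℝ) : ℂ) = (1 / (2 * (π : ℂ))) *
      ∫ u : ℝ, Complex.exp (((R : ℂ) - I * u) * h) *
        Complex.exp ((1 + I * u - R) * Real.log K) / ((I * u - R) * (1 + I * u - R)) := by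
  have hσ : 0 < -R := by linarith
  have hx : 0 < Real.exp h / K := by positivity
  have hmel (u : ℝ) : mellin (fun t : ℝ => ((max (1 - t) 0 : ℝ) : ℂ)) (((-R : ℝ) : ℂ) + u * I) =
      1 / ((((-R : ℝ) : ℂ) + u * I) * (((-R : ℝ) : ℂ) + u * I + 1)) :=
    (hasMellin_max_one_sub (by simpa using hR)).2
  have hinv := mellinInv_mellin_eq (-R) (fun t : ℝ => ((max (1 - t) 0 : ℝ) : ℂ)) hx
    (hasMellin_max_one_sub (by simpa using hR)).1
    (by
      unfold VerticalIntegrable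
      simp only [hmel]
      exact integrable_inv_vertical_mul_add_one hσ)
    (by fun_prop)
  have hpay : ((max (K - Real.exp h) 0 : ℝ) : ℂ) =
      K * ((max (1 - Real.exp h / K) 0 : ℝ) : ℂ) := by
    rw [← ofReal_mul, mul_max_of_nonneg _ _ hK.le]
    congr 2
    · field_simp
    · simp
  rw [hpay, ← hinv, mellinInv]
  simp only [hmel, smul_eq_mul, real_smul]
  rw [mul_left_comm, ← integral_const_mul]
  push_cast
  congr 1
  refine integral_congr_ae (.of_forall fun u => ?_)
  have hlog : Complex.log ((Real.exp h / K : ℝ) : ℂ) = h - Real.log K := by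
    rw [← ofReal_log hx.le, Real.log_div (Real.exp_ne_zero _) hK.ne', Real.log_exp, ofReal_sub]
  have hKexp : (K : ℂ) = Complex.exp (Real.log K) := by
    rw [← ofReal_exp, Real.exp_log hK]
  have hcpow := cpow_def_of_ne_zero (ofReal_ne_zero.2 hx.ne') (-(-(R : ℂ) + u * I))
  rw [hlog] at hcpow
  push_cast at hcpow
  dsimp only
  rw [hcpow, ← mul_assoc, hKexp, ← Complex.exp_add, ← Complex.exp_add, mul_one_div]
  congr 1
  · congr 1; ring
  · ring

/-- Fourier-based valuation formula for a floor (put): if `H` is a real random variable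
with `E[e^{RH}] < ∞`, `K > 0` and `R < 0`, then
`E[(K − e^H)⁺] = (1/2π) ∫_ℝ M_H(R−iu) · K^{1+iu−R} / ((iu−R)(1+iu−R)) du`,
where `M_H(z) = E[e^{zH}]`. -/
theorem put_valuation_fourier {Ω : Type*} [MeasurableSpace Ω] (P : Measure Ω)
    [IsProbabilityMeasure P] (H : Ω → ℝ) (hH : Measurable H) (K R : ℝ)
    (hK : 0 < K) (hR : R < 0)
    (hInt : Integrable (fun ω => Real.exp (R * H ω)) P) :
    ((∫ ω, max (K - Real.exp (H ω)) 0 ∂P : ℝ) : ℂ)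
      = (1 / (2 * (π : ℂ))) *
          ∫ u : ℝ, (∫ ω, Complex.exp (((R : ℂ) - Complex.I * u) * H ω) ∂P) *
            Complex.exp ((1 + Complex.I * u - R) * Real.log K) /
              ((Complex.I * u - R) * (1 + Complex.I * u - R)) := by
  rw [← integral_complex_ofReal]
  simp_rw [put_payoff_eq_integral K R _ hK hR]
  rw [integral_const_mul, integral_integral_swap]
  · congr 1
    refine integral_congr_ae (.of_forall fun u => ?_)
    simp only [mul_div_assoc, integral_mul_const]
  · have hvert := integrable_inv_vertical_mul_add_one (neg_pos.2 hR)
    refine ((hInt.mul_prod hvert.norm).const_mul (Real.exp ((1 - R) * Real.log K))).mono' ?_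
      (.of_forall fun p => ?_)
    · refine Measurable.aestronglyMeasurable ?_
      simp only [Function.uncurry_def]
      fun_prop
    · simp only [Function.uncurry_def]
      rw [norm_div, norm_mul, Complex.norm_exp, Complex.norm_exp, norm_div, norm_one]
      have hden : (I * p.2 - R) * (1 + I * p.2 - R) =
          (((-R : ℝ) : ℂ) + p.2 * I) * (((-R : ℝ) : ℂ) + p.2 * I + 1) := by
        push_cast; ring
      rw [hden]
      refine le_of_eq ?_
      simp
      ring
end

section
/- Let λ be a measure on ℝ with λ({0}) = 0 and ∫_ℝ min(1, x²) λ(dx) < ∞, let M' > 0, suppose that ∫_{|x|>1} e^{ux} λ(dx) < ∞ for every u ∈ [−M', M'], and let b ∈ ℝ and c ≥ 0. Then the function θ(z) = bz + (c/2)z² + ∫_ℝ (e^{zx} − 1 − zx) λ(dx) is complex-differentiable (holomorphic) at every point of the open strip {z ∈ ℂ : −M' < Re z < M'}. -/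
open MeasureTheory Complex

/-- The dominating function for the Lévy–Khintchine integrand: `x²` near the origin and
`e^{M|x|}` away from it. -/
noncomputable def levyMajorant (M x : ℝ) : ℝ :=
  if |x| ≤ 1 then x ^ 2 else Real.exp (M * |x|)

theorem measurable_levyMajorant (M : ℝ) : Measurable (levyMajorant M) := by
  unfold levyMajorant
  refine Measurable.ite (measurableSet_le (by fun_prop) (by fun_prop)) (by fun_prop) (by fun_prop)

theorem integrable_levyMajorant {lev : Measure ℝ} {M : ℝ}
    (hlev : ∫⁻ x, ENNReal.ofReal (min 1 (x ^ 2)) ∂lev < ⊤)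
    (hpos : ∫⁻ x in {x : ℝ | 1 < |x|}, ENNReal.ofReal (Real.exp (M * x)) ∂lev < ⊤)
    (hneg : ∫⁻ x in {x : ℝ | 1 < |x|}, ENNReal.ofReal (Real.exp (-M * x)) ∂lev < ⊤) :
    Integrable (levyMajorant M) lev := by
  have hS : MeasurableSet {x : ℝ | 1 < |x|} := measurableSet_lt (by fun_prop) (by fun_prop)
  have hmin : Integrable (fun x : ℝ => min 1 (x ^ 2)) lev :=
    (lintegral_ofReal_ne_top_iff_integrable (by fun_prop)
      (.of_forall fun x => by positivity)).1 hlev.ne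
  have hexp (u : ℝ)
      (hu : ∫⁻ x in {x : ℝ | 1 < |x|}, ENNReal.ofReal (Real.exp (u * x)) ∂lev < ⊤) :
      Integrable ({x : ℝ | 1 < |x|}.indicator fun x => Real.exp (u * x)) lev :=
    (integrable_indicator_iff hS).2 <|
      (lintegral_ofReal_ne_top_iff_integrable (by fun_prop)
        (.of_forall fun x => (Real.exp_pos _).le)).1 hu.ne
  refine (hmin.add ((hexp M hpos).add (hexp (-M) hneg))).mono'
    (measurable_levyMajorant M).aestronglyMeasurable (.of_forall fun x => ?_)
  simp only [levyMajorant, Pi.add_apply, Set.indicator_apply, Set.mem_ofPred_eq]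
  split_ifs with h1 h2 h2
  · exact absurd h1 h2.not_ge
  · rw [Real.norm_of_nonneg (sq_nonneg x), min_eq_right ((sq_le_one_iff_abs_le_one x).2 h1)]
    simp
  · rw [Real.norm_of_nonneg (Real.exp_pos _).le]
    have hm : 0 ≤ min 1 (x ^ 2) := by positivity
    have hp := Real.exp_pos (M * x)
    have hn := Real.exp_pos (-M * x)
    rcases abs_choice x with h | h
    · rw [h]
      linarith
    · rw [h, show M * -x = -M * x by ring]
      linarith
  · exact absurd (not_le.1 h1) h2

theorem norm_exp_mul_ofReal_le {w : ℂ} {r : ℝ} (hw : |w.re| ≤ r) (x : ℝ) :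
    ‖exp (w * x)‖ ≤ Real.exp (r * |x|) := by
  rw [norm_exp, Real.exp_le_exp, re_mul_ofReal]
  calc w.re * x ≤ |w.re * x| := le_abs_self _
    _ = |w.re| * |x| := abs_mul _ _
    _ ≤ r * |x| := by gcongr

theorem abs_le_exp_mul_abs_div {δ : ℝ} (hδ : 0 < δ) (x : ℝ) :
    |x| ≤ Real.exp (δ * |x|) / δ := by
  rw [le_div_iff₀ hδ, mul_comm]
  linarith [Real.add_one_le_exp (δ * |x|)]

theorem norm_exp_sub_one_sub_id_le_levyMajorant {w : ℂ} {M r K : ℝ} (hrM : r < M)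
    (hw : |w.re| ≤ r) (hK : ‖w‖ ≤ K) (x : ℝ) :
    ‖exp (w * x) - 1 - w * x‖ ≤
      (K ^ 2 * Real.exp K + 2 + K / (M - r)) * levyMajorant M x := by
  have hr : 0 ≤ r := (abs_nonneg _).trans hw
  have hδ : 0 < M - r := sub_pos.2 hrM
  have hK0 : 0 ≤ K := (norm_nonneg _).trans hK
  have hnorm : ‖w * (x : ℂ)‖ = ‖w‖ * |x| := by rw [norm_mul, norm_real, Real.norm_eq_abs]
  unfold levyMajorant
  split_ifs with hx
  · have h := norm_exp_sub_sum_le_norm_mul_exp (w * x) 2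
    simp only [Finset.sum_range_succ, Finset.sum_range_zero, pow_zero, pow_one, Nat.factorial,
      Nat.cast_one, div_one, zero_add, mul_one, ← sub_sub] at h
    calc ‖exp (w * x) - 1 - w * x‖ ≤ (‖w‖ * |x|) ^ 2 * Real.exp (‖w‖ * |x|) := by
          rw [← hnorm]; exact h
      _ ≤ (K * |x|) ^ 2 * Real.exp (K * 1) := by gcongr
      _ = (K ^ 2 * Real.exp K) * x ^ 2 := by rw [mul_pow, sq_abs, mul_one]; ring
      _ ≤ _ := by
          gcongr
          have : 0 ≤ K / (M - r) := by positivity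
          linarith
  · have h1 : ‖exp (w * x)‖ ≤ Real.exp (M * |x|) := norm_exp_mul_ofReal_le (hw.trans hrM.le) x
    have h2 : 1 ≤ Real.exp (M * |x|) :=
      Real.one_le_exp (mul_nonneg (hr.trans hrM.le) (abs_nonneg x))
    have h3 : |x| ≤ Real.exp (M * |x|) / (M - r) := by
      refine (abs_le_exp_mul_abs_div hδ x).trans ?_
      gcongr
      linarith
    calc ‖exp (w * x) - 1 - w * x‖ ≤ ‖exp (w * x)‖ + 1 + ‖w‖ * |x| := by
          rw [← hnorm, ← norm_one (α := ℂ)]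
          exact (norm_sub_le _ _).trans (by gcongr; exact norm_sub_le _ _)
      _ ≤ Real.exp (M * |x|) + Real.exp (M * |x|) + K * (Real.exp (M * |x|) / (M - r)) := by
          gcongr
      _ = (0 + 2 + K / (M - r)) * Real.exp (M * |x|) := by ring
      _ ≤ _ := by gcongr; positivity

theorem norm_mul_exp_sub_one_le_levyMajorant {w : ℂ} {M r K : ℝ} (hrM : r < M)
    (hw : |w.re| ≤ r) (hK : ‖w‖ ≤ K) (x : ℝ) :
    ‖(x : ℂ) * (exp (w * x) - 1)‖ ≤
      (K * Real.exp K + 2 / (M - r)) * levyMajorant M x := by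
  have hr : 0 ≤ r := (abs_nonneg _).trans hw
  have hδ : 0 < M - r := sub_pos.2 hrM
  have hK0 : 0 ≤ K := (norm_nonneg _).trans hK
  have hnorm : ‖w * (x : ℂ)‖ = ‖w‖ * |x| := by rw [norm_mul, norm_real, Real.norm_eq_abs]
  rw [norm_mul, norm_real, Real.norm_eq_abs]
  unfold levyMajorant
  split_ifs with hx
  · have h := norm_exp_sub_sum_le_norm_mul_exp (w * x) 1
    simp only [Finset.sum_range_one, pow_zero, pow_one, Nat.factorial, Nat.cast_one, div_one] at h
    calc |x| * ‖exp (w * x) - 1‖ ≤ |x| * (‖w‖ * |x| * Real.exp (‖w‖ * |x|)) := by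
          rw [← hnorm]; gcongr
      _ ≤ |x| * (K * |x| * Real.exp (K * 1)) := by gcongr
      _ = (K * Real.exp K + 0) * x ^ 2 := by rw [← sq_abs x, mul_one]; ring
      _ ≤ _ := by gcongr; positivity
  · have h1 : ‖exp (w * x)‖ ≤ Real.exp (r * |x|) := norm_exp_mul_ofReal_le hw x
    have h2 : 1 ≤ Real.exp (r * |x|) := Real.one_le_exp (mul_nonneg hr (abs_nonneg x))
    have h3 : ‖exp (w * x) - 1‖ ≤ 2 * Real.exp (r * |x|) := by
      have := norm_sub_le (exp (w * x)) 1
      rw [norm_one] at this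
      linarith
    calc |x| * ‖exp (w * x) - 1‖
        ≤ Real.exp ((M - r) * |x|) / (M - r) * (2 * Real.exp (r * |x|)) := by
          gcongr
          exact abs_le_exp_mul_abs_div hδ x
      _ = (0 + 2 / (M - r)) * Real.exp (M * |x|) := by
          rw [show M * |x| = (M - r) * |x| + r * |x| by ring, Real.exp_add]; ring
      _ ≤ _ := by gcongr; positivity

/-- Under the exponential moment assumption, the cumulant generating function
`θ(z) = bz + (c/2)z² + ∫ (e^{zx} − 1 − zx) λ(dx)` associated with a Lévy triplet
`(b, c, λ)` is holomorphic on the open strip `{z : −M' < Re z < M'}`. -/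
theorem levy_cumulant_holomorphic (lev : Measure ℝ)
    (h0 : lev {0} = 0)
    (hlev : ∫⁻ x, ENNReal.ofReal (min 1 (x ^ 2)) ∂lev < ⊤)
    (M' : ℝ) (hM' : 0 < M')
    (hexp : ∀ u ∈ Set.Icc (-M') M',
      ∫⁻ x in {x : ℝ | 1 < |x|}, ENNReal.ofReal (Real.exp (u * x)) ∂lev < ⊤)
    (b : ℝ) (c : ℝ) (hc : 0 ≤ c) :
    ∀ z : ℂ, -M' < z.re → z.re < M' →
      DifferentiableAt ℂ
        (fun w : ℂ => (b : ℂ) * w + ((c : ℂ) / 2) * w ^ 2 +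
          ∫ x : ℝ, (Complex.exp (w * x) - 1 - w * x) ∂lev) z := by
  intro z hz1 hz2
  have hmaj : Integrable (levyMajorant M') lev :=
    integrable_levyMajorant hlev (hexp M' ⟨by linarith, le_rfl⟩)
      (hexp (-M') ⟨le_rfl, by linarith⟩)
  obtain ⟨r, hzr, hrM⟩ := exists_between (abs_lt.2 ⟨hz1, hz2⟩)
  set s : Set ℂ := {w | |w.re| < r ∧ ‖w‖ < ‖z‖ + 1}
  have hs : s ∈ nhds z :=
    ((isOpen_lt continuous_re.abs continuous_const).inter
      (isOpen_lt continuous_norm continuous_const)).mem_nhds ⟨hzr, lt_add_one ‖z‖⟩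
  have hint : HasDerivAt (fun w : ℂ => ∫ x : ℝ, (Complex.exp (w * x) - 1 - w * x) ∂lev)
      (∫ x : ℝ, (x : ℂ) * (Complex.exp (z * x) - 1) ∂lev) z := by
    refine (hasDerivAt_integral_of_dominated_loc_of_deriv_le (μ := lev)
      (F := fun (w : ℂ) (x : ℝ) => Complex.exp (w * x) - 1 - w * x)
      (F' := fun (w : ℂ) (x : ℝ) => (x : ℂ) * (Complex.exp (w * x) - 1)) hs
      (.of_forall fun w => by fun_prop) ?_ (by fun_prop)
      (.of_forall fun x w hw => norm_mul_exp_sub_one_le_levyMajorant hrM hw.1.le hw.2.le x)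
      (hmaj.const_mul _) (.of_forall fun x w _ => ?_)).2
    · exact (hmaj.const_mul _).mono' (by fun_prop)
        (.of_forall fun x => norm_exp_sub_one_sub_id_le_levyMajorant hrM hzr.le le_rfl x)
    · have hlin : HasDerivAt (fun w : ℂ => w * (x : ℂ)) x w := hasDerivAt_mul_const _
      exact ((hlin.cexp.sub_const 1).sub hlin).congr_deriv (by ring)
  exact DifferentiableAt.add (by fun_prop) hint.differentiableAt
end
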